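/- In a discrete matching model with deterministic impatience p under FCFM, a word w of length 2p is a synchronizing word if and only if it is strongly synchronizing, i.e., if and only if for all i ∈ {1,...,p} and all j ∈ {p+1,...,p+i}, w_i and w_j are not adjacent in the compatibility graph G. -/

import Mathlib

/-- Word-profile state of the matching model with deterministic patience `p`:
a list of length `p` over `𝕍 ∪ {0}`, oldest item first; `none` encodes the letter `0`. -/
abbrev MState (V : Type*) := List (Option V)

/-- An admissible matching policy: given the current word-profile and the class of the
arriving item, it either returns the position of the stored item it is matched with
(which must hold a compatible class), or `none`, which is only allowed when no stored
item is compatible. -/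
def Admissible {V : Type*} (G : SimpleGraph V) (Φ : MState V → V → Option ℕ) : Prop :=
  ∀ (x : MState V) (c : V),
    (∀ i : ℕ, Φ x c = some i → ∃ d : V, x.getD i none = some d ∧ G.Adj c d) ∧
    (Φ x c = none → ∀ (i : ℕ) (d : V), x.getD i none = some d → ¬ G.Adj c d)

/-- One step of the word-profile chain under policy `Φ`: the match (if any) is erased and
replaced by `0`, the oldest item leaves, and the arrival is recorded (as its class if
unmatched, as `0` if matched). -/
def mstep {V : Type*} (Φ : MState V → V → Option ℕ) (x : MState V) (c : V) : MState V :=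
  match Φ x c with
  | some i => (x.set i none).tail ++ [none]
  | none => x.tail ++ [some c]

/-- `W Φ x w`: state reached from `x` after feeding the arrival word `w`. -/
def W {V : Type*} (Φ : MState V → V → Option ℕ) (x : MState V) (w : List V) : MState V :=
  w.foldl (mstep Φ) x

/-- The First Come, First Matched policy: the arrival is matched with the oldest
compatible stored item, if any. -/
def fcfm {V : Type*} (G : SimpleGraph V) [DecidableRel G.Adj] :
    MState V → V → Option ℕ :=
  fun x c => x.findIdx? (fun o => o.elim false fun d => decide (G.Adj c d))

/-- A word `w` of length `2p` is strongly synchronizing if (1-indexed) `w_i ⌣̸ w_j` for all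
`i ∈ {1,…,p}` and `j ∈ {p+1,…,p+i}`; here indices are 0-based. -/
def StronglySync {V : Type*} [Inhabited V] (G : SimpleGraph V) (p : ℕ) (w : List V) : Prop :=
  w.length = 2 * p ∧
    ∀ i j : ℕ, i < p → p ≤ j → j ≤ p + i → ¬ G.Adj (w.getD i default) (w.getD j default)

/-- `w` is synchronizing if all initial word-profiles are driven to a common state. -/
def Synchronizing {V : Type*} (Φ : MState V → V → Option ℕ) (p : ℕ) (w : List V) : Prop :=
  ∃ z : MState V, ∀ x : MState V, x.length = p → W Φ x w = z

/-- The word-profile at time `t` read off a history `h`, in which the initial items occupy the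
indices `0, …, p - 1` and the `k`-th arrival occupies the index `p + k`. -/
def window {V : Type*} (p : ℕ) (h : ℕ → Option V) (t : ℕ) : MState V :=
  (List.range p).map fun l => h (t + l)

/-- One FCFM step on histories, at time `t` with arrival `c`. -/
def HistStep {V : Type*} (G : SimpleGraph V) (p t : ℕ) (c : V) (h h' : ℕ → Option V) : Prop :=
  (∃ q d, t ≤ q ∧ q < t + p ∧ h q = some d ∧ G.Adj c d ∧
      (∀ r e, t ≤ r → r < q → h r = some e → ¬ G.Adj c e) ∧
      h' q = none ∧ h' (p + t) = none ∧ ∀ r, r ≠ q → r ≠ p + t → h' r = h r) ∨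
  ((∀ r e, t ≤ r → r < t + p → h r = some e → ¬ G.Adj c e) ∧
      h' (p + t) = some c ∧ ∀ r, r ≠ p + t → h' r = h r)

theorem exists_histStep {V : Type*} (G : SimpleGraph V) [DecidableRel G.Adj] (p : ℕ)
    (hp : 0 < p) (t : ℕ) (c : V) (h : ℕ → Option V) :
    ∃ h', HistStep G p t c h h' ∧ mstep (fcfm G) (window p h t) c = window p h' (t + 1) := by
  cases hf : fcfm G (window p h t) c with
  | none =>
    refine ⟨Function.update h (p + t) (some c), Or.inr ⟨?_, by simp, ?_⟩, ?_⟩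
    · intro r e h1 h2 h3 h4
      rw [fcfm, List.findIdx?_eq_none_iff] at hf
      have := hf (h r) (by
        simp only [window, List.mem_map, List.mem_range]
        exact ⟨r - t, by omega, by congr 1; omega⟩)
      simp [h3, h4] at this
    · intro r hr
      simp [hr]
    · simp only [mstep, hf]
      apply List.ext_getElem
      · simp [window]; omega
      · intro n h1 h2
        simp only [window, List.length_map, List.length_range] at h2
        by_cases hn : n = p - 1
        · rw [List.getElem_append_right (by simp [window]; omega)]
          simp [window, show t + 1 + n = p + t by omega]
        · rw [List.getElem_append_left (by simp [window]; omega)]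
          simp [window, Function.update, show t + 1 + n ≠ p + t by omega,
            show t + (n + 1) = t + 1 + n by omega]
  | some i =>
    have hf' := hf
    rw [fcfm, List.findIdx?_eq_some_iff_getElem] at hf'
    obtain ⟨hi, ha, hm⟩ := hf'
    have hip : i < p := by simpa [window] using hi
    refine ⟨Function.update (Function.update h (t + i) none) (p + t) none,
      Or.inl ?_, ?_⟩
    · simp only [window, List.getElem_map, List.getElem_range] at ha hm
      cases hd : h (t + i) with
      | none => simp [hd] at ha
      | some d =>
        refine ⟨t + i, d, by omega, by omega, hd, by simpa [hd] using ha, ?_, ?_, by simp, ?_⟩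
        · intro r e h1 h2 h3 h4
          have := hm (r - t) (by omega)
          rw [show t + (r - t) = r by omega, h3] at this
          simp [h4] at this
        · simp [Function.update]
        · intro r h1 h2
          simp [h1, h2]
    · simp only [mstep, hf]
      apply List.ext_getElem
      · simp [window]; omega
      · intro n h1 h2
        simp only [window, List.length_map, List.length_range] at h2
        by_cases hn : n = p - 1
        · rw [List.getElem_append_right (by simp [window]; omega)]
          simp [window, show t + 1 + n = p + t by omega]
        · rw [List.getElem_append_left (by simp [window]; omega)]
          have : (i = n + 1) ↔ (t + 1 + n = t + i) := by omega
          simp [window, Function.update, show t + 1 + n ≠ p + t by omega, List.getElem_set,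
            show t + (n + 1) = t + 1 + n by omega, this]

theorem W_window_induction {V : Type*} [Inhabited V] (G : SimpleGraph V) [DecidableRel G.Adj]
    (p : ℕ) (hp : 0 < p) (w : List V) (P : ℕ → (ℕ → Option V) → (ℕ → Option V) → Prop)
    (f g : ℕ → Option V) (h0 : P 0 f g)
    (hs : ∀ t < w.length, ∀ h h' k k', P t h k → HistStep G p t (w.getD t default) h h' →
      HistStep G p t (w.getD t default) k k' → P (t + 1) h' k') :
    ∃ h k, P w.length h k ∧ W (fcfm G) (window p f 0) w = window p h w.length ∧
      W (fcfm G) (window p g 0) w = window p k w.length := by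
  suffices H : ∀ n ≤ w.length, ∃ h k, P n h k ∧
      W (fcfm G) (window p f 0) (w.take n) = window p h n ∧
      W (fcfm G) (window p g 0) (w.take n) = window p k n by
    simpa using H w.length le_rfl
  intro n
  induction n with
  | zero => exact fun _ => ⟨f, g, h0, by simp [W], by simp [W]⟩
  | succ n ih =>
    intro hn
    obtain ⟨h, k, hP, h1, h2⟩ := ih (by omega)
    obtain ⟨h', s1, e1⟩ := exists_histStep G p hp n (w.getD n default) h
    obtain ⟨k', s2, e2⟩ := exists_histStep G p hp n (w.getD n default) k
    refine ⟨h', k', hs n hn h h' k k' hP s1 s2, ?_, ?_⟩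
    · rw [← e1, ← h1, List.take_succ_eq_append_getElem hn, List.getD_eq_getElem _ _ hn]
      simp only [W, List.foldl_append, List.foldl_cons, List.foldl_nil]
    · rw [← e2, ← h2, List.take_succ_eq_append_getElem hn, List.getD_eq_getElem _ _ hn]
      simp only [W, List.foldl_append, List.foldl_cons, List.foldl_nil]

theorem window_getD {V : Type*} (p : ℕ) (x : MState V) (hx : x.length = p) :
    window p (fun k => x.getD k none) 0 = x := by
  apply List.ext_getElem
  · simp [window, hx]
  · intro n h1 h2
    simp [window, h2]

/-- If no arrival of the first half can be matched with one of the second half, then two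
runs agree on the second half. -/
theorem W_eq_of_stronglySync {V : Type*} [Inhabited V] (G : SimpleGraph V) [DecidableRel G.Adj]
    (p : ℕ) (hp : 0 < p) (w : List V) (hw : StronglySync G p w) (x y : MState V)
    (hx : x.length = p) (hy : y.length = p) : W (fcfm G) x w = W (fcfm G) y w := by
  obtain ⟨hl, hw⟩ := hw
  obtain ⟨h, k, ⟨-, -, he⟩, e1, e2⟩ := W_window_induction G p hp w
    (fun t h k => (∀ r < t, r < p → ∀ d, h (p + r) = some d → d = w.getD r default) ∧
      (∀ r < t, r < p → ∀ d, k (p + r) = some d → d = w.getD r default) ∧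
      ∀ r < t, p ≤ r → h (p + r) = k (p + r))
    (fun k => x.getD k none) (fun k => y.getD k none) (by simp) (by
      rintro t ht h h' k k' ⟨hh, hk, he⟩ s1 s2
      have mono : ∀ u u' : ℕ → Option V,
          (∀ r < t, r < p → ∀ d, u (p + r) = some d → d = w.getD r default) →
          HistStep G p t (w.getD t default) u u' →
          (∀ r < t + 1, r < p → ∀ d, u' (p + r) = some d → d = w.getD r default) := by
        intro u u' hu s r hr hrp d hd
        rcases s with ⟨q, e, -, -, -, -, -, h1, h2, h3⟩ | ⟨-, h2, h3⟩
        · by_cases hq : p + r = q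
          · simp [hq, h1] at hd
          · by_cases hrt : r = t
            · simp [hrt, h2] at hd
            · exact hu r (by omega) hrp d (by rw [← hd, h3 _ hq (by omega)])
        · by_cases hrt : r = t
          · subst hrt
            rw [h2] at hd
            exact (Option.some.inj hd).symm
          · exact hu r (by omega) hrp d (by rw [← hd, h3 _ (by omega)])
      refine ⟨mono h h' hh s1, mono k k' hk s2, ?_⟩
      intro r hr hpr
      have old : ∀ u : ℕ → Option V,
          (∀ r < t, r < p → ∀ d, u (p + r) = some d → d = w.getD r default) →
          ∀ q d, t ≤ q → u q = some d → G.Adj (w.getD t default) d → p + p ≤ q := by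
        intro u hu q d hq hd ha
        by_contra hlt
        have := hu (q - p) (by omega) (by omega) d (by rw [← hd]; congr 1; omega)
        subst this
        exact hw (q - p) t (by omega) (by omega) (by omega) ha.symm
      have eq : ∀ q, p + p ≤ q → q < t + p → h q = k q := by
        intro q h1 h2
        have := he (q - p) (by omega) (by omega)
        rwa [show p + (q - p) = q by omega] at this
      rcases s1 with ⟨q, d, a1, a2, a3, a4, a5, a6, a7, a8⟩ | ⟨a5, a7, a8⟩ <;>
      rcases s2 with ⟨q', d', b1, b2, b3, b4, b5, b6, b7, b8⟩ | ⟨b5, b7, b8⟩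
      · have c1 := old h hh q d a1 a3 a4
        have c2 := old k hk q' d' b1 b3 b4
        have : q = q' := by
          rcases lt_trichotomy q q' with hlt | heq | hlt
          · exact absurd a4 (b5 q d a1 hlt (by rw [← eq q c1 a2, a3]))
          · exact heq
          · exact absurd b4 (a5 q' d' b1 hlt (by rw [eq q' c2 b2, b3]))
        subst this
        by_cases hq : p + r = q
        · rw [hq, a6, b6]
        · by_cases hrt : r = t
          · rw [hrt, a7, b7]
          · rw [a8 _ hq (by omega), b8 _ hq (by omega), he r (by omega) hpr]
      · have c1 := old h hh q d a1 a3 a4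
        exact absurd a4 (b5 q d a1 a2 (by rw [← eq q c1 a2, a3]))
      · have c2 := old k hk q' d' b1 b3 b4
        exact absurd b4 (a5 q' d' b1 b2 (by rw [eq q' c2 b2, b3]))
      · by_cases hrt : r = t
        · rw [hrt, a7, b7]
        · rw [a8 _ (by omega), b8 _ (by omega), he r (by omega) hpr])
  rw [window_getD p x hx] at e1
  rw [window_getD p y hy] at e2
  rw [e1, e2, window, window]
  apply List.map_congr_left
  intro l hl'
  have := he (p + l) (by simp at hl'; omega) (by omega)
  rw [show w.length + l = p + (p + l) by omega, this]

/-- The number of unmatched items among the first `n` arrivals of the second half. -/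
def unmatched {V : Type*} (p : ℕ) (h : ℕ → Option V) (n : ℕ) : ℕ :=
  ∑ k ∈ Finset.range n, if (h (p + p + k)).isSome then 1 else 0

theorem unmatched_congr {V : Type*} (p : ℕ) (h h' : ℕ → Option V) (n : ℕ)
    (e : ∀ k < n, h (p + p + k) = h' (p + p + k)) : unmatched p h n = unmatched p h' n := by
  apply Finset.sum_congr rfl
  intro k hk
  rw [e k (Finset.mem_range.1 hk)]

theorem unmatched_erase {V : Type*} (p : ℕ) (h h' : ℕ → Option V) (n q : ℕ) (d : V) (hq : q < n)
    (hd : h (p + p + q) = some d) (hn : h' (p + p + q) = none)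
    (e : ∀ k < n, k ≠ q → h (p + p + k) = h' (p + p + k)) :
    unmatched p h n = unmatched p h' n + 1 := by
  have hm : q ∈ Finset.range n := Finset.mem_range.2 hq
  rw [unmatched, unmatched, ← Finset.add_sum_erase _ _ hm, ← Finset.add_sum_erase _ _ hm]
  have : ∑ k ∈ (Finset.range n).erase q, (if (h (p + p + k)).isSome then 1 else 0) =
      ∑ k ∈ (Finset.range n).erase q, (if (h' (p + p + k)).isSome then 1 else 0) := by
    apply Finset.sum_congr rfl
    intro k hk
    rw [Finset.mem_erase, Finset.mem_range] at hk
    rw [e k hk.2 hk.1]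
  rw [this]
  simp [hd, hn]
  omega

/-- For a cut index `i ≤ p`, there is an initial state from which every non-isolated arrival
before `i` is matched with an initial item, while the arrival `i` (if `i < p`) stays
unmatched during the first half. If no later arrival of the first half can meet a
compatible arrival of the second half, this determines the parity of the number of
unmatched items in the final state. -/
theorem exists_state_parity {V : Type*} [Inhabited V] (G : SimpleGraph V) [DecidableRel G.Adj]
    (p : ℕ) (hp : 0 < p) (w : List V) (hw : w.length = 2 * p) (i j : ℕ)
    (hij : i < p → p ≤ j ∧ j ≤ p + i ∧ G.Adj (w.getD i default) (w.getD j default))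
    (hmax : ∀ k l, i < k → k < p → p ≤ l → l ≤ p + k →
      ¬ G.Adj (w.getD k default) (w.getD l default)) :
    ∃ x : MState V, x.length = p ∧ ∃ h, W (fcfm G) x w = window p h (p + p) ∧
      unmatched p h p % 2 = (if i < p then p + 1 else p) % 2 := by
  classical
  set a : ℕ → V := fun k => w.getD k default
  have ha' : ∀ k, w.getD k default = a k := fun _ => rfl
  simp only [ha'] at hij hmax
  obtain ⟨f, f1, f2, f3, f4⟩ : ∃ f : ℕ → Option V,
      (∀ k < i, (∃ d, f k = some d ∧ G.Adj (a k) d) ∨ (f k = none ∧ ∀ d, ¬ G.Adj (a k) d)) ∧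
      (∀ k, i ≤ k → ∀ d, f k = some d → d = a i) ∧
      (∀ k, i < k → G.Adj (a k) (a i) → f k = some (a i)) ∧ f i = none := by
    refine ⟨fun k => if k < i then (if hd : ∃ d, G.Adj (a k) d then some hd.choose else none)
      else if i < k ∧ G.Adj (a k) (a i) then some (a i) else none, ?_, ?_, ?_, by simp⟩
    · intro k hk
      by_cases hd : ∃ d, G.Adj (a k) d
      · exact Or.inl ⟨hd.choose, by simp [hk, hd], hd.choose_spec⟩
      · exact Or.inr ⟨by simp only [hk, hd, if_true, dif_neg, not_false_eq_true], by simpa using hd⟩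
    · intro k hk d
      simp only [show ¬ k < i by omega, if_false]
      split_ifs with h
      · intro h; exact (Option.some.inj h).symm
      · simp
    · intro k hk hd
      simp [hk, hd, show ¬ k < i by omega]
  obtain ⟨h, -, ⟨-, -, -, hD⟩, e1, -⟩ := W_window_induction G p hp w
    (fun t h _ => (∀ k, t ≤ k → k < p → h k = f k) ∧
      (∀ k < t, k < p → k < i → ∀ d, h (p + k) = some d → ∀ c, ¬ G.Adj c d) ∧
      (∀ k < t, k < p → i < k → ∀ d, h (p + k) = some d → d = a k) ∧
      ((unmatched p h (t - p) % 2 = (t - p) % 2 ∧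
          (i < t → i < p → h (p + i) = some (a i) ∧ t ≤ j)) ∨
        (unmatched p h (t - p) % 2 = (t - p + 1) % 2 ∧ i < p ∧ p < t ∧ h (p + i) = none)))
    f f ⟨by simp, by simp, by simp, Or.inl ⟨by simp [unmatched], by omega⟩⟩ (by
      rintro t ht h h' - - ⟨A, B1, B2, D⟩ s -
      simp only [ha'] at s
      have keep : ∀ r d, h' r = some d → r ≠ p + t → h r = some d := by
        intro r d hd hr
        rcases s with ⟨q, -, -, -, -, -, -, h1, -, h3⟩ | ⟨-, -, h3⟩
        · by_cases hq : r = q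
          · simp [hq, h1] at hd
          · rw [← h3 r hq hr, hd]
        · rw [← h3 r hr, hd]
      have new : ∀ d, h' (p + t) = some d →
          d = a t ∧ ∀ r e, t ≤ r → r < t + p → h r = some e → ¬ G.Adj (a t) e := by
        intro d hd
        rcases s with ⟨q, -, -, -, -, -, -, -, h2, -⟩ | ⟨h1, h2, -⟩
        · simp [h2] at hd
        · rw [h2] at hd
          exact ⟨(Option.some.inj hd).symm, h1⟩
      have B1' : ∀ k < t + 1, k < p → k < i → ∀ d, h' (p + k) = some d → ∀ c, ¬ G.Adj c d := by
        intro k hk hkp hki d hd c hc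
        by_cases hkt : k = t
        · subst hkt
          obtain ⟨rfl, hno⟩ := new d hd
          rcases f1 k hki with ⟨e, h1, h2⟩ | ⟨-, h2⟩
          · exact hno k e le_rfl (by omega) (by rw [A k le_rfl hkp, h1]) h2
          · exact h2 c hc.symm
        · exact B1 k (by omega) hkp hki d (keep _ d hd (by omega)) c hc
      have B2' : ∀ k < t + 1, k < p → i < k → ∀ d, h' (p + k) = some d → d = a k := by
        intro k hk hkp hki d hd
        by_cases hkt : k = t
        · subst hkt
          exact (new d hd).1
        · exact B2 k (by omega) hkp hki d (keep _ d hd (by omega))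
      rcases lt_or_ge t p with htp | htp
      · have hD : i < t → h (p + i) = some (a i) := by
          intro hit
          rcases D with ⟨-, h1⟩ | ⟨-, -, h1, -⟩
          · exact (h1 hit (by omega)).1
          · omega
        have A' : (∀ k, t + 1 ≤ k → k < p → h' k = f k) ∧ (i < t + 1 → h' (p + i) = some (a i)) := by
          rcases s with ⟨q, d, h1, h2, h3, h4, h5, h6, h7, h8⟩ | ⟨h5, h7, h8⟩
          · have hq : (q = t ∧ t ≠ i) ∨ (i < t ∧ p + i < q) := by
              have hold : p ≤ q → i ≤ q - p := by
                intro hpq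
                by_contra hlt
                exact B1 (q - p) (by omega) (by omega) (by omega) d
                  (by rw [← h3]; congr 1; omega) _ h4
              rcases lt_trichotomy t i with hti | hti | hti
              · rcases f1 t hti with ⟨e, g1, g2⟩ | ⟨-, g2⟩
                · by_contra hne
                  exact h5 t e le_rfl (by omega) (by rw [A t le_rfl htp, g1]) g2
                · exact absurd h4 (g2 d)
              · rcases lt_or_ge q p with hqp | hqp
                · rw [A q h1 hqp] at h3
                  have := f2 q (by omega) d h3
                  rw [this, hti] at h4
                  exact absurd h4 (G.irrefl)
                · have := hold hqp
                  omega
              · by_cases hadj : G.Adj (a t) (a i)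
                · by_contra hne
                  exact h5 t (a i) le_rfl (by omega) (by rw [A t le_rfl htp, f3 t hti hadj]) hadj
                · rcases lt_or_ge q p with hqp | hqp
                  · rw [A q h1 hqp] at h3
                    rw [f2 q (by omega) d h3] at h4
                    exact absurd h4 hadj
                  · have := hold hqp
                    by_cases hqi : q = p + i
                    · rw [hqi, hD hti] at h3
                      rw [← Option.some.inj h3] at h4
                      exact absurd h4 hadj
                    · omega
            refine ⟨fun k hk hkp => ?_, fun hi => ?_⟩
            · rw [h8 k (by omega) (by omega), A k (by omega) hkp]
            · rw [h8 _ (by omega) (by omega), hD (by omega)]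
          · refine ⟨fun k hk hkp => ?_, fun hi => ?_⟩
            · rw [h8 k (by omega), A k (by omega) hkp]
            · by_cases hit : i = t
              · rw [hit, h7]
              · rw [h8 _ (by omega), hD (by omega)]
        refine ⟨A'.1, B1', B2', Or.inl ⟨?_, fun h1 h2 => ⟨A'.2 h1, ?_⟩⟩⟩
        · simp [unmatched, show t + 1 - p = 0 by omega]
        · have := hij h2
          omega
      · refine ⟨by omega, B1', B2', ?_⟩
        have hsucc : t + 1 - p = (t - p) + 1 := by omega
        have hlast : p + p + (t - p) = p + t := by omega
        have hcount : unmatched p h' (t + 1 - p) =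
            unmatched p h' (t - p) + if (h' (p + t)).isSome then 1 else 0 := by
          rw [hsucc, unmatched, Finset.sum_range_succ, hlast, unmatched]
        rcases s with ⟨q, d, h1, h2, h3, h4, h5, h6, h7, h8⟩ | ⟨h5, h7, h8⟩
        · rw [hcount, h7]
          rcases lt_or_ge q (p + p) with hq | hq
          · have hqi : q = p + i := by
              have e : h (p + (q - p)) = some d := by rw [← h3]; congr 1; omega
              rcases lt_trichotomy (q - p) i with hlt | heq | hlt
              · exact absurd h4 (B1 (q - p) (by omega) (by omega) hlt d e _)
              · omega
              · rw [B2 (q - p) (by omega) (by omega) hlt d e] at h4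
                exact absurd h4.symm (hmax (q - p) t hlt (by omega) htp (by omega))
            subst hqi
            have : unmatched p h' (t - p) = unmatched p h (t - p) :=
              unmatched_congr _ _ _ _ fun k hk => h8 _ (by omega) (by omega)
            rcases D with ⟨g1, -⟩ | ⟨-, -, -, g⟩
            · refine Or.inr ⟨?_, by omega, by omega, h6⟩
              simp
              omega
            · rw [g] at h3
              cases h3
          · have : unmatched p h (t - p) = unmatched p h' (t - p) + 1 := by
              refine unmatched_erase _ _ _ _ (q - (p + p)) d (by omega) ?_ ?_ ?_
              · rw [← h3]; congr 1; omega
              · rw [← h6]; congr 1; omega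
              · intro k hk hkq
                exact (h8 _ (by omega) (by omega)).symm
            rcases D with ⟨g1, g2⟩ | ⟨g1, g2, g3, g4⟩
            · refine Or.inl ⟨by simp; omega, fun hi hip => ?_⟩
              obtain ⟨u1, u2⟩ := g2 (by omega) hip
              refine ⟨by rw [h8 _ (by omega) (by omega), u1], ?_⟩
              by_contra hlt
              obtain rfl : t = j := by omega
              exact h5 (p + i) (a i) (hij hip).2.1 (by omega) u1 (hij hip).2.2.symm
            · exact Or.inr ⟨by simp; omega, g2, by omega,
                by rw [h8 _ (by omega) (by omega), g4]⟩
        · have : unmatched p h' (t - p) = unmatched p h (t - p) :=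
            unmatched_congr _ _ _ _ fun k hk => h8 _ (by omega)
          rw [hcount, h7]
          rcases D with ⟨g1, g2⟩ | ⟨g1, g2, g3, g4⟩
          · refine Or.inl ⟨by simp; omega, fun hi hip => ?_⟩
            obtain ⟨u1, u2⟩ := g2 (by omega) hip
            refine ⟨by rw [h8 _ (by omega), u1], ?_⟩
            by_contra hlt
            obtain rfl : t = j := by omega
            exact h5 (p + i) (a i) (hij hip).2.1 (by omega) u1 (hij hip).2.2.symm
          · exact Or.inr ⟨by simp; omega, g2, by omega, by rw [h8 _ (by omega), g4]⟩)
  refine ⟨window p f 0, by simp [window], h, by rw [e1]; congr 1; omega, ?_⟩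
  rw [hw, show 2 * p - p = p by omega] at hD
  split_ifs with hi
  · rcases hD with ⟨-, h2⟩ | ⟨h1, -⟩
    · have := h2 (by omega) hi
      have := hij hi
      omega
    · exact h1
  · rcases hD with ⟨h1, -⟩ | ⟨-, h2, -⟩
    · exact h1
    · omega

theorem unmatched_eq_of_window_eq {V : Type*} (p : ℕ) (h h' : ℕ → Option V)
    (e : window p h (p + p) = window p h' (p + p)) : unmatched p h p = unmatched p h' p := by
  apply unmatched_congr
  intro k hk
  exact List.map_inj_left.1 e k (List.mem_range.2 hk)

/-- Under FCFM, a word of length `2p` is synchronizing iff it is strongly synchronizing. -/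
theorem stmt7 {V : Type*} [Inhabited V] (G : SimpleGraph V) [DecidableRel G.Adj]
    (p : ℕ) (hp : 0 < p) (w : List V) (hw : w.length = 2 * p) :
    Synchronizing (fcfm G) p w ↔ StronglySync G p w := by
  constructor
  · rintro ⟨z, hz⟩
    refine ⟨hw, ?_⟩
    by_contra! hcon
    classical
    let Q : ℕ → Prop := fun i => i < p ∧ ∃ j, p ≤ j ∧ j ≤ p + i ∧
      G.Adj (w.getD i default) (w.getD j default)
    obtain ⟨i₀, j₀, h₁, h₂, h₃, h₄⟩ := hcon
    obtain ⟨hi, j, hj⟩ : Q (Nat.findGreatest Q p) :=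
      Nat.findGreatest_spec h₁.le ⟨h₁, j₀, h₂, h₃, h₄⟩
    obtain ⟨x, hx, h, e, par⟩ := exists_state_parity G p hp w hw (Nat.findGreatest Q p) j
      (fun _ => hj) fun k l hk hkp h1 h2 h3 =>
        Nat.findGreatest_is_greatest hk hkp.le ⟨hkp, l, h1, h2, h3⟩
    obtain ⟨y, hy, h', e', par'⟩ := exists_state_parity G p hp w hw p 0
      (fun h => absurd h (lt_irrefl p)) fun k l hk hkp => absurd hk hkp.not_gt
    rw [hz x hx] at e
    rw [hz y hy] at e'
    have := unmatched_eq_of_window_eq p h h' (e.symm.trans e')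
    rw [if_pos hi, this] at par
    rw [if_neg (lt_irrefl p)] at par'
    omega
  · intro hs
    exact ⟨W (fcfm G) (List.replicate p none) w, fun x hx =>
      W_eq_of_stronglySync G p hp w hs x _ hx (by simp)⟩
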